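/- Let $m \geq n$ be positive integers. Taking $x = m+1$ in the partial fraction identity yields: $\sum_{k=0}^{n} \binom{m+k}{k}\binom{m}{k}\binom{n+k}{k}\binom{n}{k}\Big\{\frac{-k}{(m+1+k)^2} + \frac{1 + k(H_{m+k}^{(1)} + H_{m-k}^{(1)} + H_{n+k}^{(1)} + H_{n-k}^{(1)} - 4H_k^{(1)})}{m+1+k}\Big\} + \sum_{k=n+1}^{m} \frac{(-1)^{k-n}}{m+1+k}\binom{m+k}{k}\binom{m}{k}\binom{n+k}{k}/\binom{k-1}{n} = \frac{(m+1)\,(-m)_n\,(-m)_m}{(m+1)_{n+1}\,(m+1)_{m+1}}$. -/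

import Mathlib

open Finset

/-- Generalized harmonicSum sum `H n^{(i)} = ∑_{j=1}^n 1/j^i`. -/
def harmonicSum (i n : ℕ) : ℚ := ∑ j ∈ Finset.range n, (1 : ℚ) / ((j : ℚ) + 1) ^ i

/-- Rising factorial `(a)_r = a(a+1)⋯(a+r-1)`. -/
def riseFact (a : ℚ) (r : ℕ) : ℚ := ∏ j ∈ Finset.range r, (a + j)

open Polynomial in
theorem eval_derivative_nodal_of_forall_ne {ι F : Type*} [Field F] [DecidableEq ι]
    (s : Finset ι) (v : ι → F) (x : F) (hx : ∀ i ∈ s, x ≠ v i) :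
    eval x (derivative (Lagrange.nodal s v))
      = eval x (Lagrange.nodal s v) * ∑ i ∈ s, (x - v i)⁻¹ := by
  rw [Lagrange.derivative_nodal, eval_finsetSum, mul_sum]
  refine sum_congr rfl fun i hi => ?_
  rw [Lagrange.nodal_eq_mul_nodal_erase hi, eval_mul, eval_sub, eval_X, eval_C]
  have := sub_ne_zero.2 (hx i hi)
  field_simp

open Polynomial in
theorem eval_derivative_node_eq {ι F : Type*} [Field F] [DecidableEq ι]
    (s : Finset ι) (v : ι → F) (hv : Set.InjOn v s) (P : F[X]) (hP : P.degree < #s)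
    (k : ι) (hk : k ∈ s) :
    eval (v k) (derivative P)
      = eval (v k) P * ∑ j ∈ s, (v k - v j)⁻¹
        + (∏ j ∈ s.erase k, (v k - v j)) *
          ∑ j ∈ s, eval (v j) P / (∏ i ∈ s.erase j, (v j - v i)) * (v k - v j)⁻¹ := by
  have hne : ∀ j ∈ s.erase k, v k ≠ v j := fun j hj h =>
    (mem_erase.1 hj).1 (hv (mem_erase.1 hj).2 hk h.symm)
  have hN : ∏ j ∈ s.erase k, (v k - v j) ≠ 0 :=
    prod_ne_zero_iff.2 fun j hj => sub_ne_zero.2 (hne j hj)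
  have key : P = ∑ j ∈ s, C (eval (v j) P / ∏ i ∈ s.erase j, (v j - v i)) *
      Lagrange.nodal (s.erase j) v := by
    conv_lhs => rw [Lagrange.eq_interpolate hv hP, Lagrange.interpolate_eq_sum]
    rfl
  conv_lhs => rw [key]
  rw [derivative_sum, eval_finsetSum, ← add_sum_erase _ _ hk]
  congr 1
  · rw [derivative_C_mul, eval_C_mul, eval_derivative_nodal_of_forall_ne _ _ _ hne,
      Lagrange.eval_nodal, ← add_sum_erase s (fun j => (v k - v j)⁻¹) hk]
    field_simp
    simp
  · rw [mul_sum, ← add_sum_erase s _ hk]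
    simp only [sub_self, inv_zero, mul_zero, zero_add]
    refine sum_congr rfl fun j hj => ?_
    have hkj : k ∈ s.erase j := mem_erase.2 ⟨(mem_erase.1 hj).1.symm, hk⟩
    rw [derivative_C_mul, eval_C_mul, Lagrange.eval_nodal_derivative_eval_node_eq hkj,
      Lagrange.eval_nodal, erase_right_comm, ← mul_prod_erase (s.erase k) _ hj]
    have := sub_ne_zero.2 (hne j hj)
    field_simp

theorem prod_range_sub_self (k : ℕ) :
    ∏ j ∈ range k, ((j : ℚ) - k) = (-1) ^ k * (k.factorial : ℚ) := by
  rw [← prod_range_reflect, ← prod_range_add_one_eq_factorial, Nat.cast_prod]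
  conv_rhs => rw [← card_range k, ← prod_const, card_range, ← prod_mul_distrib]
  refine prod_congr rfl fun j hj => ?_
  have : j < k := mem_range.1 hj
  rw [Nat.sub_sub, Nat.cast_sub (by omega)]
  push_cast
  ring

theorem prod_erase_sub (k d : ℕ) :
    ∏ j ∈ (range (k + d + 1)).erase k, ((j : ℚ) - k)
      = (-1) ^ k * (k.factorial : ℚ) * (d.factorial : ℚ) := by
  induction d with
  | zero =>
    rw [add_zero, range_add_one, erase_insert notMem_range_self, prod_range_sub_self]
    simp
  | succ d ih =>
    rw [range_add_one, erase_insert_of_ne (by omega), prod_insert (by simp), ← add_assoc, ih,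
      Nat.factorial_succ]
    push_cast
    ring

theorem prod_range_sub (n d : ℕ) :
    (∏ j ∈ range (n + 1), ((j : ℚ) - (n + 1 + d : ℕ))) * (d.factorial : ℚ)
      = (-1) ^ (n + 1) * ((n + 1 + d).factorial : ℚ) := by
  have h := prod_range_sub_self (n + 1 + d)
  rw [prod_range_add] at h
  have h2 : ∏ x ∈ range d, (((n + 1 + x : ℕ) : ℚ) - (n + 1 + d : ℕ))
      = (-1) ^ d * (d.factorial : ℚ) := by
    rw [← prod_range_sub_self d]
    refine prod_congr rfl fun j _ => ?_
    push_cast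
    ring
  rw [h2, pow_add] at h
  have h3 : ((-1 : ℚ) ^ d) ≠ 0 := pow_ne_zero _ (by norm_num)
  apply mul_left_cancel₀ h3
  linear_combination h

theorem harmonicSum_one_succ (n : ℕ) :
    harmonicSum 1 (n + 1) = harmonicSum 1 n + ((n : ℚ) + 1)⁻¹ := by
  simp [harmonicSum, sum_range_succ]

theorem sum_inv_sub (k d : ℕ) :
    ∑ j ∈ range (k + d + 1), ((j : ℚ) - k)⁻¹ = harmonicSum 1 d - harmonicSum 1 k := by
  induction d with
  | zero =>
    rw [add_zero, sum_range_succ, ← sum_range_reflect, sub_self, inv_zero, add_zero]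
    simp only [harmonicSum, range_zero, sum_empty, zero_sub, ← sum_neg_distrib]
    refine sum_congr rfl fun j hj => ?_
    have : j < k := mem_range.1 hj
    rw [Nat.sub_sub, Nat.cast_sub (by omega), pow_one, one_div, ← inv_neg]
    push_cast
    congr 1
    ring
  | succ d ih =>
    rw [sum_range_succ, ← add_assoc, ih, harmonicSum_one_succ]
    push_cast
    ring

theorem sum_inv_add (n k : ℕ) :
    ∑ i ∈ range n, ((k : ℚ) + i + 1)⁻¹ = harmonicSum 1 (n + k) - harmonicSum 1 k := by
  induction n with
  | zero => simp
  | succ n ih =>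
    rw [sum_range_succ, ih, Nat.add_right_comm, harmonicSum_one_succ]
    push_cast
    ring

theorem prod_add_mul_factorial (n k : ℕ) :
    (∏ i ∈ range n, ((i : ℚ) + 1 + k)) * (k.factorial : ℚ) = ((n + k).factorial : ℚ) := by
  induction n with
  | zero => simp
  | succ n ih =>
    rw [prod_range_succ, Nat.add_right_comm, Nat.factorial_succ, Nat.cast_mul, ← ih]
    push_cast
    ring

/-- The polynomial `(1 - X)(2 - X)⋯(n - X)`. -/
noncomputable def prodSub (n : ℕ) : Polynomial ℚ :=
  Polynomial.C ((-1) ^ n) * Lagrange.nodal (range n) fun i => (i : ℚ) + 1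

theorem eval_prodSub (n : ℕ) (x : ℚ) :
    (prodSub n).eval x = ∏ i ∈ range n, ((i : ℚ) + 1 - x) := by
  rw [prodSub, Polynomial.eval_C_mul, Lagrange.eval_nodal]
  conv_lhs => rw [← card_range n, ← prod_const, card_range, ← prod_mul_distrib]
  exact prod_congr rfl fun i _ => by ring

theorem degree_prodSub_lt (n : ℕ) : (prodSub n).degree < #(range (n + 1)) := by
  rw [prodSub, Polynomial.degree_C_mul (pow_ne_zero _ (by norm_num)), Lagrange.degree_nodal,
    card_range, card_range]
  exact_mod_cast n.lt_succ_self

theorem eval_derivative_prodSub (n k : ℕ) :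
    (Polynomial.derivative (prodSub n)).eval (-(k : ℚ))
      = -(prodSub n).eval (-(k : ℚ)) * (harmonicSum 1 (n + k) - harmonicSum 1 k) := by
  have h : ∀ i ∈ range n, -(k : ℚ) ≠ (i : ℚ) + 1 := fun i _ h => by
    have : (0 : ℚ) < (i : ℚ) + 1 + k := by positivity
    linarith
  rw [prodSub, Polynomial.derivative_C_mul, Polynomial.eval_C_mul, Polynomial.eval_C_mul,
    eval_derivative_nodal_of_forall_ne _ _ _ h, ← sum_inv_add]
  have h2 : ∑ i ∈ range n, (-(k : ℚ) - ((i : ℚ) + 1))⁻¹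
      = -∑ i ∈ range n, ((k : ℚ) + i + 1)⁻¹ := by
    rw [← sum_neg_distrib]
    refine sum_congr rfl fun i _ => ?_
    rw [← inv_neg]
    congr 1
    ring
  rw [h2]
  ring

/-- The residue of `(1 - x)_n / (x)_{n+1}` at `x = -k`. -/
def residue (n k : ℕ) : ℚ := (-1) ^ k * (n.choose k : ℚ) * ((n + k).choose k : ℚ)

theorem eval_prodSub_div_prod (n k : ℕ) (hk : k ∈ range (n + 1)) :
    (prodSub n).eval (-(k : ℚ)) / ∏ j ∈ (range (n + 1)).erase k, (-(k : ℚ) - -(j : ℚ))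
      = residue n k := by
  obtain ⟨d, rfl⟩ := Nat.exists_eq_add_of_le (Nat.lt_succ_iff.1 (mem_range.1 hk))
  have h1 : ∏ j ∈ (range (k + d + 1)).erase k, (-(k : ℚ) - -(j : ℚ))
      = (-1) ^ k * (k.factorial : ℚ) * (d.factorial : ℚ) := by
    rw [← prod_erase_sub]
    exact prod_congr rfl fun _ _ => by ring
  have h2 := prod_add_mul_factorial (k + d) k
  have h3 : (prodSub (k + d)).eval (-(k : ℚ)) = ∏ i ∈ range (k + d), ((i : ℚ) + 1 + k) := by
    rw [eval_prodSub]
    exact prod_congr rfl fun _ _ => by ring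
  rw [h1, h3, eq_div_of_mul_eq (by positivity) h2, residue, Nat.cast_choose ℚ (by omega),
    Nat.cast_choose ℚ (by omega : k ≤ k + d + k), Nat.add_sub_cancel, Nat.add_sub_cancel_left]
  have h4 : ((-1 : ℚ) ^ k) * (-1) ^ k = 1 := by rw [← mul_pow]; norm_num
  have h5 : ((-1 : ℚ) ^ k) ≠ 0 := pow_ne_zero _ (by norm_num)
  field_simp
  linear_combination -h4

theorem injOn_neg_natCast (s : Set ℕ) : Set.InjOn (fun j : ℕ => -(j : ℚ)) s :=
  fun _ _ _ _ h => by simpa using h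

theorem prod_div_prod_eq_sum_residue (n : ℕ) (x : ℚ) (hx : ∀ j ∈ range (n + 1), x + j ≠ 0) :
    (∏ i ∈ range n, ((i : ℚ) + 1 - x)) / ∏ j ∈ range (n + 1), (x + j)
      = ∑ j ∈ range (n + 1), residue n j / (x + j) := by
  have hx' : ∀ j ∈ range (n + 1), x ≠ -(j : ℚ) := fun j hj h => hx j hj (by rw [h]; ring)
  have h := Lagrange.eval_interpolate_not_at_node (s := range (n + 1)) (v := fun j : ℕ => -(j : ℚ))
    (fun j => (prodSub n).eval (-(j : ℚ))) hx'
  rw [← Lagrange.eq_interpolate (injOn_neg_natCast _) (degree_prodSub_lt n), eval_prodSub,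
    Lagrange.eval_nodal] at h
  simp only [sub_neg_eq_add] at h
  rw [h, mul_div_cancel_left₀ _ (prod_ne_zero_iff.2 hx)]
  refine sum_congr rfl fun j hj => ?_
  rw [← eval_prodSub_div_prod n j hj, Lagrange.nodalWeight, prod_inv_distrib]
  ring

theorem sum_residue_div_sub_of_le (n k : ℕ) (hk : k ≤ n) :
    ∑ j ∈ range (n + 1), residue n j / ((k : ℚ) - j)
      = residue n k * (harmonicSum 1 (n + k) + harmonicSum 1 (n - k) - 2 * harmonicSum 1 k) := by
  have hk' : k ∈ range (n + 1) := mem_range.2 (by omega)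
  have h := eval_derivative_node_eq (range (n + 1)) (fun j : ℕ => -(j : ℚ))
    (injOn_neg_natCast _) (prodSub n) (degree_prodSub_lt n) k hk'
  have hN : ∏ j ∈ (range (n + 1)).erase k, (-(k : ℚ) - -(j : ℚ)) ≠ 0 := by
    refine prod_ne_zero_iff.2 fun j hj h0 => (mem_erase.1 hj).1 ?_
    exact_mod_cast (by linarith : (j : ℚ) = k)
  have hc := eval_prodSub_div_prod n k hk'
  rw [div_eq_iff hN] at hc
  have h1 : ∑ j ∈ range (n + 1), (-(k : ℚ) - -(j : ℚ))⁻¹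
      = harmonicSum 1 (n - k) - harmonicSum 1 k := by
    rw [← sum_inv_sub, Nat.add_sub_cancel' hk]
    exact sum_congr rfl fun _ _ => by congr 1; ring
  have h2 : ∑ j ∈ range (n + 1), (prodSub n).eval (-(j : ℚ)) /
      (∏ i ∈ (range (n + 1)).erase j, (-(j : ℚ) - -(i : ℚ))) * (-(k : ℚ) - -(j : ℚ))⁻¹
      = -∑ j ∈ range (n + 1), residue n j / ((k : ℚ) - j) := by
    rw [← sum_neg_distrib]
    refine sum_congr rfl fun j hj => ?_
    rw [eval_prodSub_div_prod n j hj, div_eq_mul_inv, ← mul_neg, ← inv_neg]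
    congr 2
    ring
  rw [h1, h2, eval_derivative_prodSub, hc] at h
  apply mul_left_cancel₀ hN
  linear_combination h

theorem sum_residue_div_sub_of_lt (n k : ℕ) (hk : n < k) :
    (k : ℚ) * ∑ j ∈ range (n + 1), residue n j / ((k : ℚ) - j)
      = (-1) ^ n * ((n + k).choose k : ℚ) / ((k - 1).choose n : ℚ) := by
  have hx : ∀ j ∈ range (n + 1), -(k : ℚ) + j ≠ 0 := fun j hj h => by
    have h1 : (j : ℚ) = k := by linarith
    have h2 : j = k := by exact_mod_cast h1
    have := mem_range.1 hj
    omega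
  have h := prod_div_prod_eq_sum_residue n (-(k : ℚ)) hx
  have h1 : ∑ j ∈ range (n + 1), residue n j / ((k : ℚ) - j)
      = -∑ j ∈ range (n + 1), residue n j / (-(k : ℚ) + j) := by
    rw [← sum_neg_distrib]
    refine sum_congr rfl fun j _ => ?_
    rw [← div_neg]
    congr 1
    ring
  rw [h1, ← h]
  obtain ⟨d, rfl⟩ := Nat.exists_eq_add_of_le (Nat.succ_le_of_lt hk)
  have h2 := prod_add_mul_factorial n (n + 1 + d)
  have h3 := prod_range_sub n d
  have h4 : ∏ i ∈ range n, ((i : ℚ) + 1 - -((n + 1 + d : ℕ) : ℚ))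
      = ((n + (n + 1 + d)).factorial : ℚ) / ((n + 1 + d).factorial : ℚ) := by
    rw [← eq_div_of_mul_eq (by positivity) h2]
    exact prod_congr rfl fun _ _ => by ring
  have h5 : ∏ j ∈ range (n + 1), (-((n + 1 + d : ℕ) : ℚ) + j)
      = (-1) ^ (n + 1) * ((n + 1 + d).factorial : ℚ) / (d.factorial : ℚ) := by
    rw [← eq_div_of_mul_eq (by positivity) h3]
    exact prod_congr rfl fun _ _ => by ring
  have h6 : (n + 1 + d) - 1 = n + d := by omega
  have h7 : ((n + 1 + d).factorial : ℚ) = ((n + 1 + d : ℕ) : ℚ) * ((n + d).factorial : ℚ) := by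
    rw [show n + 1 + d = n + d + 1 by omega, Nat.factorial_succ, Nat.cast_mul]
  rw [Nat.succ_eq_add_one, h4, h5, h6, Nat.cast_choose ℚ (by omega : n + 1 + d ≤ n + (n + 1 + d)),
    Nat.cast_choose ℚ (by omega : n ≤ n + d), Nat.add_sub_cancel, Nat.add_sub_cancel_left, h7,
    pow_succ]
  have h8 : ((-1 : ℚ) ^ n) * (-1) ^ n = 1 := by rw [← mul_pow]; norm_num
  have h9 : ((-1 : ℚ) ^ n) ≠ 0 := pow_ne_zero _ (by norm_num)
  have h10 : ((n + 1 + d : ℕ) : ℚ) ≠ 0 := by positivity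
  field_simp
  linear_combination -h8

theorem residue_mul_residue (m n k : ℕ) :
    residue m k * residue n k = ((m + k).choose k : ℚ) * (m.choose k : ℚ)
      * ((n + k).choose k : ℚ) * (n.choose k : ℚ) := by
  have h : ((-1 : ℚ) ^ k) * (-1) ^ k = 1 := by rw [← mul_pow]; norm_num
  unfold residue
  linear_combination ((m + k).choose k : ℚ) * (m.choose k : ℚ)
      * ((n + k).choose k : ℚ) * (n.choose k : ℚ) * h

theorem mul_sum_div_mul_sum_div (a b : ℕ → ℚ) (m n : ℕ) (hmn : n ≤ m) (x : ℚ)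
    (hx : ∀ j : ℕ, x + j ≠ 0) :
    x * (∑ k ∈ range (m + 1), a k / (x + k)) * (∑ j ∈ range (n + 1), b j / (x + j))
      = ∑ k ∈ range (m + 1), a k * k / (x + k) * ∑ j ∈ range (n + 1), b j / ((k : ℚ) - j)
        + ∑ j ∈ range (n + 1), b j * j / (x + j) * ∑ k ∈ range (m + 1), a k / ((j : ℚ) - k)
        + ∑ k ∈ range (n + 1), a k * b k * x / (x + k) ^ 2 := by
  have hd : ∑ k ∈ range (n + 1), a k * b k * x / (x + k) ^ 2
      = ∑ j ∈ range (n + 1), ∑ k ∈ range (m + 1),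
        if k = j then a k * b k * x / (x + k) ^ 2 else 0 := by
    refine sum_congr rfl fun j hj => ?_
    have := mem_range.1 hj
    rw [sum_ite_eq' (range (m + 1)) j, if_pos (mem_range.2 (by omega))]
  rw [hd, mul_assoc, sum_mul_sum, sum_comm, mul_sum]
  simp only [mul_sum]
  rw [sum_comm (s := range (m + 1)), ← sum_add_distrib, ← sum_add_distrib]
  refine sum_congr rfl fun j _ => ?_
  rw [← sum_add_distrib, ← sum_add_distrib]
  refine sum_congr rfl fun k _ => ?_
  have hj := hx j
  have hk := hx k
  by_cases h : k = j
  · subst h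
    rw [if_pos rfl]
    simp only [sub_self, div_zero, mul_zero, zero_add]
    field_simp
  · rw [if_neg h]
    have h1 : (k : ℚ) - j ≠ 0 := sub_ne_zero.2 (by exact_mod_cast h)
    have h2 : (j : ℚ) - k = -((k : ℚ) - j) := by ring
    rw [h2]
    field_simp
    ring

theorem stmt_13 (m n : ℕ) (hn : 0 < n) (hmn : n ≤ m) :
    (∑ k ∈ Finset.range (n + 1),
      ((m + k).choose k : ℚ) * (m.choose k : ℚ) * ((n + k).choose k : ℚ) * (n.choose k : ℚ) *
        (-(k : ℚ) / ((m : ℚ) + 1 + k) ^ 2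
          + (1 + (k : ℚ) * (harmonicSum 1 (m + k) + harmonicSum 1 (m - k) + harmonicSum 1 (n + k)
              + harmonicSum 1 (n - k) - 4 * harmonicSum 1 k)) / ((m : ℚ) + 1 + k)))
    + (∑ k ∈ Finset.Icc (n + 1) m,
      (-1 : ℚ) ^ (k - n) / ((m : ℚ) + 1 + k) * ((m + k).choose k : ℚ) * (m.choose k : ℚ)
        * ((n + k).choose k : ℚ) / ((k - 1).choose n : ℚ))
    = ((m : ℚ) + 1) * riseFact (-(m : ℚ)) n * riseFact (-(m : ℚ)) m
        / (riseFact ((m : ℚ) + 1) (n + 1) * riseFact ((m : ℚ) + 1) (m + 1)) := by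
  have hx : ∀ j : ℕ, (m : ℚ) + 1 + j ≠ 0 := fun j => by positivity
  have hr : ∀ l : ℕ, riseFact (-(m : ℚ)) l / riseFact ((m : ℚ) + 1) (l + 1)
      = ∑ j ∈ range (l + 1), residue l j / ((m : ℚ) + 1 + j) := fun l => by
    rw [← prod_div_prod_eq_sum_residue l _ fun j _ => hx j, riseFact, riseFact]
    congr 1
    exact prod_congr rfl fun _ _ => by ring
  have hR : ((m : ℚ) + 1) * riseFact (-(m : ℚ)) n * riseFact (-(m : ℚ)) m
        / (riseFact ((m : ℚ) + 1) (n + 1) * riseFact ((m : ℚ) + 1) (m + 1))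
      = ((m : ℚ) + 1) * (riseFact (-(m : ℚ)) m / riseFact ((m : ℚ) + 1) (m + 1))
        * (riseFact (-(m : ℚ)) n / riseFact ((m : ℚ) + 1) (n + 1)) := by
    rw [mul_assoc, mul_div_assoc, mul_div_mul_comm]
    ring
  rw [hR, hr, hr, mul_sum_div_mul_sum_div _ _ m n hmn _ hx]
  have hs : ∀ f : ℕ → ℚ, ∑ k ∈ range (m + 1), f k
      = ∑ k ∈ range (n + 1), f k + ∑ k ∈ Icc (n + 1) m, f k := fun f => by
    rw [← sum_range_add_sum_Ico f (by omega : n + 1 ≤ m + 1)]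
    congr 1
  rw [hs (fun k => residue m k * k / ((m : ℚ) + 1 + k) * _),
    show ∀ a b c d : ℚ, a + b + c + d = a + c + d + b from fun _ _ _ _ => by ring]
  have h2 : ∑ k ∈ Icc (n + 1) m, (-1 : ℚ) ^ (k - n) / ((m : ℚ) + 1 + k) * ((m + k).choose k : ℚ)
        * (m.choose k : ℚ) * ((n + k).choose k : ℚ) / ((k - 1).choose n : ℚ)
      = ∑ k ∈ Icc (n + 1) m, residue m k * k / ((m : ℚ) + 1 + k)
        * ∑ j ∈ range (n + 1), residue n j / ((k : ℚ) - j) := by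
    refine sum_congr rfl fun k hk => ?_
    have hk' := mem_Icc.1 hk
    have hS := sum_residue_div_sub_of_lt n k (by omega)
    rw [mul_div_right_comm _ (k : ℚ), mul_assoc _ (k : ℚ), hS, residue]
    obtain ⟨d, rfl⟩ := Nat.exists_eq_add_of_le (by omega : n ≤ k)
    have h : ((-1 : ℚ) ^ n) * (-1) ^ n = 1 := by rw [← mul_pow]; norm_num
    rw [Nat.add_sub_cancel_left, pow_add]
    linear_combination -(-1 : ℚ) ^ d / ((m : ℚ) + 1 + (n + d : ℕ))
      * ((m + (n + d)).choose (n + d) : ℚ) * (m.choose (n + d) : ℚ)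
      * ((n + (n + d)).choose (n + d) : ℚ) / ((n + d - 1).choose n : ℚ) * h
  rw [h2]
  congr 1
  rw [← sum_add_distrib, ← sum_add_distrib]
  refine sum_congr rfl fun k hk => ?_
  have hk' : k ≤ n := Nat.lt_succ_iff.1 (mem_range.1 hk)
  rw [sum_residue_div_sub_of_le n k hk', sum_residue_div_sub_of_le m k (hk'.trans hmn),
    ← residue_mul_residue]
  have := hx k
  field_simp
  ring
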